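/- Let R be an integral domain of characteristic zero and let 𝔲 be a set of derivations of R. For an integer i define G_i ⊆ R by: G_i = {0} for i < 0, and for i ≥ 0, G_i = {x ∈ R : D_{i+1}(D_i(⋯(D_1(x))⋯)) = 0 for every choice of D_1, …, D_{i+1} ∈ 𝔲}. If i, j ≥ 0, x ∈ G_i with x ∉ G_{i−1}, and y ∈ G_j with y ∉ G_{j−1}, then xy ∈ G_{i+j} and xy ∉ G_{i+j−1}; in particular there exist derivations D_1, …, D_{i+j} ∈ 𝔲 such that D_{i+j}(⋯(D_1(xy))⋯) ≠ 0. -/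

import Mathlib

/-- Apply a list of operators to an element, the head of the list being applied first. -/
def iterApp {R : Type*} : List (R → R) → R → R
  | [], x => x
  | D :: Ds, x => iterApp Ds (D x)

/-- A derivation of a commutative ring: an additive map satisfying the Leibniz rule. -/
def IsDerivation {R : Type*} [CommRing R] (D : R → R) : Prop :=
  (∀ a b : R, D (a + b) = D a + D b) ∧ (∀ a b : R, D (a * b) = D a * b + a * D b)

/-- The Socle filtration associated to a set `u` of derivations: `G i = {0}` for `i < 0`, and
for `i ≥ 0`, `G i` consists of the elements annihilated by every composite of `i + 1`
derivations from `u`. -/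
def SocleG {R : Type*} [CommRing R] (u : Set (R → R)) (i : ℤ) : Set R :=
  if i < 0 then {0}
  else {x | ∀ Ds : List (R → R), (∀ D ∈ Ds, D ∈ u) → Ds.length = i.toNat + 1 →
    iterApp Ds x = 0}

section Socle

variable {R : Type*} [CommRing R] {u : Set (R → R)}

/-- `x` is annihilated by every composite of `n` operators from `u`. -/
def KilledBy (u : Set (R → R)) (n : ℕ) (x : R) : Prop :=
  ∀ Ds : List (R → R), (∀ D ∈ Ds, D ∈ u) → Ds.length = n → iterApp Ds x = 0

theorem killedBy_zero_iff {x : R} : KilledBy u 0 x ↔ x = 0 := by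
  constructor
  · intro h
    exact h [] (by simp) rfl
  · rintro rfl Ds _ hl
    rw [List.length_eq_zero_iff] at hl
    simp [hl, iterApp]

theorem killedBy_succ_iff {n : ℕ} {x : R} :
    KilledBy u (n + 1) x ↔ ∀ D ∈ u, KilledBy u n (D x) := by
  constructor
  · intro h D hD Ds hDs hl
    exact h (D :: Ds) (by simpa using ⟨hD, hDs⟩) (by simp [hl])
  · intro h Ds hDs hl
    cases Ds with
    | nil => simp at hl
    | cons D Ds =>
      simp only [List.mem_cons, forall_eq_or_imp] at hDs
      exact h D hDs.1 Ds hDs.2 (by simpa using hl)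

theorem IsDerivation.map_zero {D : R → R} (hD : IsDerivation D) : D 0 = 0 := by
  simpa using hD.1 0 0

theorem iterApp_add (hu : ∀ D ∈ u, IsDerivation D) {Ds : List (R → R)}
    (hDs : ∀ D ∈ Ds, D ∈ u) (x y : R) :
    iterApp Ds (x + y) = iterApp Ds x + iterApp Ds y := by
  induction Ds generalizing x y with
  | nil => rfl
  | cons D Ds ih =>
    simp only [List.mem_cons, forall_eq_or_imp] at hDs
    simp only [iterApp, (hu D hDs.1).1, ih hDs.2]

theorem iterApp_mul_of_killedBy_one (hu : ∀ D ∈ u, IsDerivation D) {Ds : List (R → R)}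
    (hDs : ∀ D ∈ Ds, D ∈ u) {x : R} (hx : KilledBy u 1 x) (y : R) :
    iterApp Ds (x * y) = x * iterApp Ds y := by
  induction Ds generalizing y with
  | nil => rfl
  | cons D Ds ih =>
    simp only [List.mem_cons, forall_eq_or_imp] at hDs
    have h : D x = 0 := killedBy_zero_iff.1 (killedBy_succ_iff.1 hx D hDs.1)
    simp only [iterApp, (hu D hDs.1).2, h, zero_mul, zero_add, ih hDs.2]

theorem KilledBy.add (hu : ∀ D ∈ u, IsDerivation D) {n : ℕ} {x y : R}
    (hx : KilledBy u n x) (hy : KilledBy u n y) : KilledBy u n (x + y) := by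
  intro Ds hDs hl
  rw [iterApp_add hu hDs, hx Ds hDs hl, hy Ds hDs hl, add_zero]

theorem killedBy_zero (hu : ∀ D ∈ u, IsDerivation D) (n : ℕ) : KilledBy u n 0 := by
  induction n with
  | zero => exact killedBy_zero_iff.2 rfl
  | succ n ih =>
    refine killedBy_succ_iff.2 fun D hD => ?_
    rwa [(hu D hD).map_zero]

theorem KilledBy.mul (hu : ∀ D ∈ u, IsDerivation D) {i j n : ℕ} {x y : R}
    (hx : KilledBy u i x) (hy : KilledBy u j y) (hn : i + j ≤ n + 1) :
    KilledBy u n (x * y) := by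
  induction n generalizing i j x y with
  | zero =>
    obtain rfl | rfl : i = 0 ∨ j = 0 := by omega
    · simp [killedBy_zero_iff.1 hx, killedBy_zero hu]
    · simp [killedBy_zero_iff.1 hy, killedBy_zero hu]
  | succ n ih =>
    cases i with
    | zero => simp [killedBy_zero_iff.1 hx, killedBy_zero hu]
    | succ i =>
      cases j with
      | zero => simp [killedBy_zero_iff.1 hy, killedBy_zero hu]
      | succ j =>
        refine killedBy_succ_iff.2 fun D hD => ?_
        rw [(hu D hD).2]
        exact (ih (killedBy_succ_iff.1 hx D hD) hy (by omega)).add hu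
          (ih hx (killedBy_succ_iff.1 hy D hD) (by omega))

theorem KilledBy.succ (hu : ∀ D ∈ u, IsDerivation D) {n : ℕ} {x : R} (hx : KilledBy u n x) :
    KilledBy u (n + 1) x := by
  induction n generalizing x with
  | zero => exact killedBy_zero_iff.1 hx ▸ killedBy_zero hu 1
  | succ n ih => exact killedBy_succ_iff.2 fun D hD => ih (killedBy_succ_iff.1 hx D hD)

theorem mem_socleG_natCast_sub_one {n : ℕ} {x : R} :
    x ∈ SocleG u ((n : ℤ) - 1) ↔ KilledBy u n x := by
  cases n with
  | zero => simp [SocleG, killedBy_zero_iff]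
  | succ n =>
    have h : ¬ (n : ℤ) < 0 := by omega
    simp [SocleG, KilledBy, h]

theorem mem_socleG_natCast {n : ℕ} {x : R} :
    x ∈ SocleG u (n : ℤ) ↔ KilledBy u (n + 1) x := by
  simpa using mem_socleG_natCast_sub_one (u := u) (n := n + 1) (x := x)

section Leading

variable [LinearOrder (R → R)]

/-- All words longer than `w` kill `x`, and so do the words of the same length that precede `w`
lexicographically. -/
def IsLeading (u : Set (R → R)) (x : R) (w : List (R → R)) : Prop :=
  KilledBy u (w.length + 1) x ∧ ∀ w' : List (R → R), (∀ D ∈ w', D ∈ u) →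
    w'.length = w.length → w' < w → iterApp w' x = 0

theorem isLeading_cons_iff {x : R} {D : R → R} (hD : D ∈ u) {w : List (R → R)} :
    IsLeading u x (D :: w) ↔ KilledBy u (w.length + 2) x ∧
      (∀ E ∈ u, E < D → KilledBy u w.length (E x)) ∧ IsLeading u (D x) w := by
  constructor
  · rintro ⟨hk, hl⟩
    refine ⟨hk, fun E hE hlt w' hw' hlen => ?_, killedBy_succ_iff.1 hk D hD,
      fun w' hw' hlen hlt => ?_⟩
    · exact hl (E :: w') (by simpa using ⟨hE, hw'⟩) (by simp [hlen])
        (List.cons_lt_cons_iff.2 (Or.inl hlt))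
    · exact hl (D :: w') (by simpa using ⟨hD, hw'⟩) (by simp [hlen])
        (List.cons_lt_cons_iff.2 (Or.inr ⟨rfl, hlt⟩))
  · rintro ⟨hk, hE, hl⟩
    refine ⟨hk, fun w' hw' hlen hlt => ?_⟩
    cases w' with
    | nil => simp at hlen
    | cons E w' =>
      simp only [List.mem_cons, forall_eq_or_imp] at hw'
      simp only [List.length_cons, Nat.add_right_cancel_iff] at hlen
      rcases List.cons_lt_cons_iff.1 hlt with h | ⟨rfl, h⟩
      · exact hE E hw'.1 h w' hw'.2 hlen
      · exact hl.2 w' hw'.2 hlen h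

theorem IsLeading.add (hu : ∀ D ∈ u, IsDerivation D) {x y : R} {w : List (R → R)}
    (hx : IsLeading u x w) (hy : IsLeading u y w) : IsLeading u (x + y) w :=
  ⟨hx.1.add hu hy.1, fun w' hw' hlen hlt => by
    rw [iterApp_add hu hw', hx.2 w' hw' hlen hlt, hy.2 w' hw' hlen hlt, add_zero]⟩

theorem IsLeading.of_lt {x : R} {v w : List (R → R)} (hx : IsLeading u x w)
    (hlen : v.length = w.length) (hlt : v < w) : IsLeading u x v :=
  ⟨hlen ▸ hx.1, fun w' hw' hl h => hx.2 w' hw' (hl.trans hlen) (h.trans hlt)⟩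

theorem KilledBy.isLeading (hu : ∀ D ∈ u, IsDerivation D) {x : R} {w : List (R → R)}
    (hx : KilledBy u w.length x) : IsLeading u x w :=
  ⟨hx.succ hu, fun w' hw' hlen _ => hx w' hw' hlen⟩

theorem IsLeading.mul_cons (hu : ∀ D ∈ u, IsDerivation D) {D E : R → R} {w v m : List (R → R)}
    {x y : R} (hD : D ∈ u) (hE : E ∈ u) (hDE : D ≤ E) (hx : IsLeading u x (D :: w))
    (hy : IsLeading u y (E :: v)) (hm : m.length = w.length + v.length + 1)
    (hxy : IsLeading u (D (x * y)) m) : IsLeading u (x * y) (D :: m) := by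
  rw [isLeading_cons_iff hD] at hx
  rw [isLeading_cons_iff hE] at hy
  refine (isLeading_cons_iff hD).2 ⟨hx.1.mul hu hy.1 (by omega), fun F hF hlt => ?_, hxy⟩
  rw [(hu F hF).2]
  exact ((hx.2.1 F hF hlt).mul hu hy.1 (by omega)).add hu
    (hx.1.mul hu (hy.2.1 F hF (hlt.trans_le hDE)) (by omega))

/-- The word `m` is leading for `x * y`, where its value is a positive multiple of `c`. -/
def IsLeadingMul (u : Set (R → R)) (x y c : R) (m : List (R → R)) : Prop :=
  (∀ D ∈ m, D ∈ u) ∧ IsLeading u (x * y) m ∧ ∃ N : ℕ, 0 < N ∧ iterApp m (x * y) = N * c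

theorem IsLeadingMul.symm {x y c : R} {m : List (R → R)} (h : IsLeadingMul u x y c m) :
    IsLeadingMul u y x c m := by
  rwa [IsLeadingMul, mul_comm y x]

theorem isLeadingMul_of_killedBy_one (hu : ∀ D ∈ u, IsDerivation D) {x y : R}
    {v : List (R → R)} (hv : ∀ D ∈ v, D ∈ u) (hx : KilledBy u 1 x) (hy : IsLeading u y v) :
    IsLeadingMul u x y (x * iterApp v y) v :=
  ⟨hv, ⟨hx.mul hu hy.1 (by omega), fun w' hw' hlen hlt => by
    rw [iterApp_mul_of_killedBy_one hu hw' hx, hy.2 w' hw' hlen hlt, mul_zero]⟩,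
    1, one_pos, by rw [iterApp_mul_of_killedBy_one hu hv hx, Nat.cast_one, one_mul]⟩

theorem IsLeadingMul.cons_of_lt (hu : ∀ D ∈ u, IsDerivation D) {D E : R → R}
    {w v m : List (R → R)} {x y c : R} (hD : D ∈ u) (hE : E ∈ u) (hDE : D < E)
    (hx : IsLeading u x (D :: w)) (hy : IsLeading u y (E :: v))
    (hm : m.length = w.length + v.length + 1) (h : IsLeadingMul u (D x) y c m) :
    IsLeadingMul u x y c (D :: m) := by
  obtain ⟨hmu, hlead, N, hN, hval⟩ := h
  have hk : KilledBy u m.length (x * D y) :=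
    hx.1.mul hu (((isLeading_cons_iff hE).1 hy).2.1 D hD hDE) (by simp; omega)
  refine ⟨by simpa using ⟨hD, hmu⟩, IsLeading.mul_cons hu hD hE hDE.le hx hy hm ?_,
    N, hN, ?_⟩
  · rw [(hu D hD).2]
    exact hlead.add hu (hk.isLeading hu)
  · rw [iterApp, (hu D hD).2, iterApp_add hu hmu, hk m hmu rfl, hval, add_zero]

theorem exists_isLeadingMul (hu : ∀ D ∈ u, IsDerivation D) {w v : List (R → R)}
    (hw : ∀ D ∈ w, D ∈ u) (hv : ∀ D ∈ v, D ∈ u) {x y : R} (hx : IsLeading u x w)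
    (hy : IsLeading u y v) : ∃ m : List (R → R), m.length = w.length + v.length ∧
      IsLeadingMul u x y (iterApp w x * iterApp v y) m := by
  induction w generalizing v x y with
  | nil => exact ⟨v, by simp, isLeadingMul_of_killedBy_one hu hv hx.1 hy⟩
  | cons D w ihw =>
    induction v generalizing x y with
    | nil =>
      refine ⟨D :: w, by simp, ?_⟩
      rw [mul_comm]
      exact (isLeadingMul_of_killedBy_one hu hw hy.1 hx).symm
    | cons E v ihv =>
      have hD : D ∈ u := hw D (by simp)
      have hE : E ∈ u := hv E (by simp)
      obtain ⟨m₁, hm₁, h₁⟩ := ihw (fun F hF => hw F (by simp [hF])) hv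
        ((isLeading_cons_iff hD).1 hx).2.2 hy
      obtain ⟨m₂, hm₂, h₂⟩ := ihv (fun F hF => hv F (by simp [hF])) hx
        ((isLeading_cons_iff hE).1 hy).2.2
      simp only [List.length_cons] at hm₁ hm₂ ⊢
      rcases lt_trichotomy D E with hlt | rfl | hlt
      · exact ⟨D :: m₁, by simp; omega,
          h₁.cons_of_lt hu hD hE hlt hx hy (by omega)⟩
      · obtain ⟨hmu₁, hl₁, N₁, hN₁, hval₁⟩ := h₁
        obtain ⟨hmu₂, hl₂, N₂, hN₂, hval₂⟩ := h₂
        have key : ∃ m : List (R → R), m.length = w.length + v.length + 1 ∧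
            (∀ F ∈ m, F ∈ u) ∧ IsLeading u (D (x * y)) m ∧ ∃ N : ℕ, 0 < N ∧
              iterApp m (D (x * y)) = N * (iterApp (D :: w) x * iterApp (D :: v) y) := by
          rw [(hu D hD).2]
          rcases lt_trichotomy m₁ m₂ with hlt | rfl | hlt
          · refine ⟨m₁, by omega, hmu₁, hl₁.add hu (hl₂.of_lt (by omega) hlt), N₁, hN₁, ?_⟩
            rw [iterApp_add hu hmu₁, hl₂.2 m₁ hmu₁ (by omega) hlt, add_zero, hval₁]
            simp only [iterApp]
          · refine ⟨m₁, by omega, hmu₁, hl₁.add hu hl₂, N₁ + N₂, by omega, ?_⟩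
            rw [iterApp_add hu hmu₁, hval₁, hval₂]
            simp only [iterApp]
            push_cast
            ring
          · refine ⟨m₂, by omega, hmu₂, (hl₁.of_lt (by omega) hlt).add hu hl₂, N₂, hN₂, ?_⟩
            rw [iterApp_add hu hmu₂, hl₁.2 m₂ hmu₂ (by omega) hlt, zero_add, hval₂]
            simp only [iterApp]
        obtain ⟨m, hm, hmu, hl, N, hN, hval⟩ := key
        exact ⟨D :: m, by simp; omega, by simpa using ⟨hD, hmu⟩,
          IsLeading.mul_cons hu hD hD le_rfl hx hy hm hl, N, hN, hval⟩
      · refine ⟨E :: m₂, by simp; omega, ?_⟩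
        rw [mul_comm] at h₂ ⊢
        exact (h₂.symm.cons_of_lt hu hE hD hlt hy hx (by omega)).symm

theorem exists_isLeading [WellFoundedLT (R → R)] {n : ℕ} {x : R} (hx : KilledBy u (n + 1) x)
    (hx' : ¬ KilledBy u n x) : ∃ w : List (R → R), (∀ D ∈ w, D ∈ u) ∧ w.length = n ∧
      IsLeading u x w ∧ iterApp w x ≠ 0 := by
  induction n generalizing x with
  | zero =>
    exact ⟨[], by simp, rfl, ⟨hx, fun w' _ _ h => absurd h (List.not_lt_nil w')⟩,
      fun h => hx' (killedBy_zero_iff.2 h)⟩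
  | succ n ih =>
    have hne : {D | D ∈ u ∧ ¬ KilledBy u n (D x)}.Nonempty := by
      rw [killedBy_succ_iff] at hx'
      push Not at hx'
      exact hx'
    obtain ⟨D, ⟨hD, hDx⟩, hmin⟩ := WellFounded.has_min wellFounded_lt _ hne
    obtain ⟨w, hw, rfl, hl, h0⟩ := ih (killedBy_succ_iff.1 hx D hD) hDx
    refine ⟨D :: w, by simpa using ⟨hD, hw⟩, rfl,
      (isLeading_cons_iff hD).2 ⟨hx, fun E hE hlt => ?_, hl⟩, h0⟩
    by_contra hk
    exact hmin E ⟨hE, hk⟩ hlt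

end Leading

end Socle

/-- In an integral domain of characteristic zero, if `x ∈ G i \ G (i-1)` and
`y ∈ G j \ G (j-1)`, then `x * y ∈ G (i+j) \ G (i+j-1)`; in particular, some composite
of `i + j` derivations from `u` does not annihilate `x * y`. -/
theorem socle_strict_multiplicative {R : Type*} [CommRing R] [IsDomain R] [CharZero R]
    (u : Set (R → R)) (hu : ∀ D ∈ u, IsDerivation D)
    (i j : ℤ) (hi : 0 ≤ i) (hj : 0 ≤ j) (x y : R)
    (hx : x ∈ SocleG u i) (hx' : x ∉ SocleG u (i - 1))
    (hy : y ∈ SocleG u j) (hy' : y ∉ SocleG u (j - 1)) :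
    x * y ∈ SocleG u (i + j) ∧ x * y ∉ SocleG u (i + j - 1) ∧
      ∃ Ds : List (R → R), (∀ D ∈ Ds, D ∈ u) ∧ Ds.length = (i + j).toNat ∧
        iterApp Ds (x * y) ≠ 0 := by
  lift i to ℕ using hi
  lift j to ℕ using hj
  rw [mem_socleG_natCast] at hx hy
  rw [mem_socleG_natCast_sub_one] at hx' hy'
  obtain ⟨_, _⟩ := exists_wellFoundedLT (R → R)
  obtain ⟨w, hw, rfl, hwl, hw0⟩ := exists_isLeading hx hx'
  obtain ⟨v, hv, rfl, hvl, hv0⟩ := exists_isLeading hy hy'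
  obtain ⟨m, hm, hmu, hml, N, hN, hval⟩ := exists_isLeadingMul hu hw hv hwl hvl
  have hm0 : iterApp m (x * y) ≠ 0 := by
    rw [hval]
    exact mul_ne_zero (Nat.cast_ne_zero.2 hN.ne') (mul_ne_zero hw0 hv0)
  rw [← Nat.cast_add, ← hm, mem_socleG_natCast, mem_socleG_natCast_sub_one]
  exact ⟨hml.1, fun h => hm0 (h m hmu rfl), m, hmu, by simp, hm0⟩
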